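/- arXiv:2206.14428 — 3 statements merged into one kernel-verified Lean document; each statement's English description precedes it below -/
import Mathlib

section
/- Let F be a field, n ≥ 1 a natural number, and x, y ∈ F with x + y ≠ 0. Then T_n(x,y) is invertible and R_nᵀ · T_n(x,y)⁻¹ · R_n = (−1)^n · (x·y/(x+y)) · u_n u_nᵀ; in particular R_nᵀ T_n(x,y)⁻¹ R_n is a matrix of rank at most 1. -/
open Matrix

/-- The matrix `T_n(x,y)` of size `2n+1`: the tridiagonal path matrix with `1`s on the
off-diagonals, `y` in the upper-right corner and `x` in the lower-left corner. -/
def Tmat (F : Type*) [Field F] (n : ℕ) (x y : F) :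
    Matrix (Fin (2*n+1)) (Fin (2*n+1)) F :=
  Matrix.of fun i j =>
    if i.val + 1 = j.val ∨ j.val + 1 = i.val then 1
    else if i.val = 0 ∧ j.val = 2*n then y
    else if i.val = 2*n ∧ j.val = 0 then x
    else 0

/-- The `(2n+1) × (2n-1)` matrix `R_n` with entries `(R_n)_{2i+1,2i} = 1` and `0` elsewhere. -/
def Rmat (F : Type*) [Field F] (n : ℕ) : Matrix (Fin (2*n+1)) (Fin (2*n-1)) F :=
  Matrix.of fun i j => if i.val = j.val + 1 ∧ Even j.val then 1 else 0

/-- The vector `u_n` of length `2n-1` with components `1, 0, -1, 0, 1, …`. -/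
def uvec (F : Type*) [Field F] (n : ℕ) : Fin (2*n-1) → F :=
  fun i => if Even i.val then (-1 : F) ^ (i.val / 2) else 0

/-- A row of `T_n` applied to a vector. -/
lemma Tmat_row (F : Type*) [Field F] (n : ℕ) (hn : 1 ≤ n) (x y : F) (g : ℕ → F)
    (i : Fin (2*n+1)) :
    ∑ k : Fin (2*n+1), Tmat F n x y i k * g k.val =
      if i.val = 0 then g 1 + y * g (2*n)
      else if i.val = 2*n then g (2*n-1) + x * g 0
      else g (i.val-1) + g (i.val+1) := by
  obtain ⟨i, hi⟩ := i
  have key : ∀ k : Fin (2*n+1), Tmat F n x y ⟨i, hi⟩ k * g k.val =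
      (fun k : ℕ => (if k = i + 1 then g k else 0) + (if k + 1 = i then g k else 0)
      + (if k = 2*n then (if i = 0 then y * g k else 0) else 0)
      + (if k = 0 then (if i = 2*n then x * g k else 0) else 0)) k.val := by
    rintro ⟨k, hk⟩
    simp only [Tmat, Matrix.of_apply]
    split_ifs <;> first | omega | simp
  rw [Finset.sum_congr rfl (fun k _ => key k)]
  rw [Fin.sum_univ_eq_sum_range (fun k : ℕ => (if k = i + 1 then g k else 0)
      + (if k + 1 = i then g k else 0)
      + (if k = 2*n then (if i = 0 then y * g k else 0) else 0)
      + (if k = 0 then (if i = 2*n then x * g k else 0) else 0)) (2*n+1)]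
  simp only [Finset.sum_add_distrib, Finset.sum_ite_eq']
  have h2 : ∑ k ∈ Finset.range (2*n+1), (if k + 1 = i then g k else 0)
      = if i = 0 then 0 else g (i-1) := by
    rcases i with _ | i
    · simp
    · simp only [Nat.add_right_cancel_iff, Finset.sum_ite_eq']
      simp; intro h; omega
  rw [h2]
  simp only [Finset.mem_range]
  by_cases h0 : i = 0
  · subst h0
    have : 1 < 2*n+1 := by omega
    have h' : 0 ≠ 2*n := by omega
    simp [this, h']
  · by_cases h1 : i = 2*n
    · subst h1; simp [h0]
    · have : i + 1 < 2*n+1 := by omega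
      simp only [h0, h1, this, if_true, if_false, ite_self, add_zero]
      exact add_comm _ _

/-- The explicit matrix `T_n⁻¹ R_n`. -/
def Wfun (F : Type*) [Field F] (n : ℕ) (x y : F) (j k : ℕ) : F :=
  if Even j then
    (if Even k then
      (if k ≤ j then (-1)^(k/2 + j/2) * (y/(x+y)) else -((-1)^(k/2 + j/2) * (x/(x+y))))
    else (-1)^(k/2 + j/2 + n) * (x*y/(x+y)))
  else 0

lemma Tmat_isUnit (F : Type*) [Field F] (n : ℕ) (hn : 1 ≤ n)
    (x y : F) (hxy : x + y ≠ 0) : IsUnit (Tmat F n x y) := by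
  rw [← Matrix.mulVec_injective_iff_isUnit]
  rw [← Matrix.coe_mulVecLin, ← LinearMap.ker_eq_bot, LinearMap.ker_eq_bot']
  intro v hv
  obtain ⟨g, hg⟩ : ∃ g : ℕ → F, ∀ k : Fin (2*n+1), v k = g k.val :=
    ⟨fun k => if h : k < 2*n+1 then v ⟨k, h⟩ else 0, fun k => by
      have := k.isLt
      simp only [this, dif_pos]⟩
  have row : ∀ i : Fin (2*n+1), _ := fun i => Tmat_row F n hn x y g i
  have z : ∀ i : Fin (2*n+1), ∑ k : Fin (2*n+1), Tmat F n x y i k * g k.val = 0 := by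
    intro i
    have := congrFun hv i
    simp only [Matrix.mulVecLin_apply, Matrix.mulVec, dotProduct, hg] at this
    exact this
  simp only [z] at row
  have r0 := row ⟨0, by omega⟩
  have r1 := row ⟨2*n, by omega⟩
  have hn0 : n ≠ 0 := by omega
  simp [hn0] at r0 r1
  have rk : ∀ k, k + 2 ≤ 2*n → g (k+2) = - g k := by
    intro k hk
    have := row ⟨k+1, by omega⟩
    have h' : k + 1 ≠ 2*n := by omega
    simp [h'] at this
    linear_combination -this
  have ev : ∀ i, i ≤ n → g (2*i) = (-1)^i * g 0 := by
    intro i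
    induction i with
    | zero => simp
    | succ i ih =>
      intro h
      rw [show 2*(i+1) = 2*i+2 by ring, rk _ (by omega), ih (by omega)]; ring
  have od : ∀ i, i < n → g (2*i+1) = (-1)^i * g 1 := by
    intro i
    induction i with
    | zero => simp
    | succ i ih =>
      intro h
      rw [show 2*(i+1)+1 = 2*i+1+2 by ring, rk _ (by omega), ih (by omega)]; ring
  have e1 := ev n le_rfl
  have o1 := od (n-1) (by omega)
  rw [show 2*(n-1)+1 = 2*n-1 by omega] at o1
  obtain ⟨m, rfl⟩ : ∃ m, n = m+1 := ⟨n-1, by omega⟩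
  simp only [Nat.add_sub_cancel] at o1
  have sq : ((-1:F)^m) * (-1)^m = 1 := by rw [← mul_pow]; simp
  rw [o1] at r1
  rw [e1, pow_succ] at r0
  have g0 : g 0 = 0 := by
    have : (x+y) * g 0 = 0 := by
      linear_combination (-1)^m * r0 - r1 - (y * g 0) * sq
    exact (mul_eq_zero.mp this).resolve_left hxy
  have g1 : g 1 = 0 := by rw [g0] at r0; simpa using r0.symm
  ext k
  rw [hg]
  obtain ⟨k, hk⟩ := k
  rcases Nat.even_or_odd' k with ⟨c, rfl | rfl⟩
  · simp [ev c (by omega), g0]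
  · simp [od c (by omega), g1]

lemma Tmat_mul_W (F : Type*) [Field F] (n : ℕ) (hn : 1 ≤ n)
    (x y : F) (hxy : x + y ≠ 0) :
    Tmat F n x y * Matrix.of (fun (k : Fin (2*n+1)) (j : Fin (2*n-1)) => Wfun F n x y j.val k.val)
      = Rmat F n := by
  ext i j
  simp only [Matrix.mul_apply, Matrix.of_apply]
  rw [Tmat_row F n hn x y (Wfun F n x y j.val) i]
  obtain ⟨i, hi⟩ := i
  obtain ⟨j, hj⟩ := j
  simp only [Rmat, Matrix.of_apply]
  by_cases hje : Even j
  swap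
  · simp [Wfun, hje]
  obtain ⟨m, rfl⟩ : ∃ m, j = 2*m := hje.exists_two_nsmul _ |>.imp (by simp)
  obtain ⟨p, rfl⟩ : ∃ p, n = p+1 := ⟨n-1, by omega⟩
  have sq (q : ℕ) : ((-1:F)^q) * (-1)^q = 1 := by rw [← mul_pow]; simp
  have We : ∀ c, Wfun F (p+1) x y (2*m) (2*c) = if c ≤ m then (-1)^(c+m) * (y/(x+y)) else
      -((-1)^(c + m) * (x/(x+y))) := by
    intro c; simp [Wfun]
  have Wo : ∀ c, Wfun F (p+1) x y (2*m) (2*c+1) = (-1)^(c+m+(p+1)) * (x*y/(x+y)) := by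
    intro c
    have : (2*c+1)/2 = c := by omega
    simp [Wfun, this]
  by_cases h0 : i = 0
  · subst h0
    have a := Wo 0
    have b := We (p+1)
    rw [if_neg (by omega)] at b
    simp only [mul_zero, zero_add] at a
    simp [a, b]
    ring
  by_cases h1 : i = 2*(p+1)
  · subst h1
    have a := Wo p
    have b := We 0
    rw [if_pos (by omega)] at b
    have e : Wfun F (p+1) x y (2*m) (2*(p+1)-1) = Wfun F (p+1) x y (2*m) (2*p+1) := rfl
    rw [if_neg h0, if_pos rfl, if_neg (by omega), e, a]
    simp only [mul_zero] at b
    rw [b, show p+m+(p+1) = m + (p+p) + 1 by ring, pow_succ, pow_add, pow_add, sq]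
    ring
  rw [if_neg h0, if_neg h1]
  rcases Nat.even_or_odd' i with ⟨c, rfl | rfl⟩
  · obtain ⟨d, rfl⟩ : ∃ d, c = d+1 := ⟨c-1, by omega⟩
    rw [show 2*(d+1)-1 = 2*d+1 by omega, Wo, Wo, if_neg (by omega)]
    ring
  · rw [show 2*c+1-1 = 2*c by omega, show 2*c+1+1 = 2*(c+1) by omega, We, We]
    rcases lt_trichotomy c m with h | h | h
    · rw [if_pos (by omega), if_pos (by omega), if_neg (by omega)]; ring
    · subst h
      rw [if_pos (by omega), if_neg (by omega), if_pos (by simp),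
        show c+1+c = c+c+1 by ring, pow_succ, pow_add, sq]
      field_simp
      ring
    · rw [if_neg (by omega), if_neg (by omega), if_neg (by omega)]; ring

lemma Rt_mul_W (F : Type*) [Field F] (n : ℕ) (x y : F) :
    (Rmat F n)ᵀ * Matrix.of (fun (k : Fin (2*n+1)) (j : Fin (2*n-1)) => Wfun F n x y j.val k.val)
      = ((-1 : F) ^ n * (x * y / (x + y))) •
          Matrix.of (fun i j => uvec F n i * uvec F n j) := by
  ext ⟨i, hi⟩ ⟨j, hj⟩
  rw [Matrix.mul_apply, Finset.sum_eq_single ⟨i+1, by omega⟩]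
  · simp only [Matrix.transpose_apply, Rmat, Matrix.of_apply, Matrix.smul_apply, uvec, Wfun,
      smul_eq_mul]
    by_cases hie : Even i
    · have h1 : ¬ Even (i+1) := by simpa [Nat.even_add_one] using hie
      have h2 : (i+1)/2 = i/2 := by obtain ⟨c, rfl⟩ := hie; omega
      by_cases hje : Even j
      · simp only [hie, hje, h1, h2, and_self, if_true, if_false]; ring
      · simp [hje]
    · simp [hie]
  · rintro ⟨k, hk⟩ _ hne
    have : k ≠ i+1 := fun h => hne (by simp [h])
    simp [Rmat, this]
  · simp

theorem Rt_Tinv_R_rank_one (F : Type*) [Field F] (n : ℕ) (hn : 1 ≤ n)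
    (x y : F) (hxy : x + y ≠ 0) :
    IsUnit (Tmat F n x y) ∧
    (Rmat F n)ᵀ * (Tmat F n x y)⁻¹ * Rmat F n
      = ((-1 : F) ^ n * (x * y / (x + y))) •
          Matrix.of (fun i j => uvec F n i * uvec F n j) ∧
    ((Rmat F n)ᵀ * (Tmat F n x y)⁻¹ * Rmat F n).rank ≤ 1 := by
  have hU := Tmat_isUnit F n hn x y hxy
  have hdet : IsUnit (Tmat F n x y).det := (Matrix.isUnit_iff_isUnit_det _).mp hU
  have hmain : (Rmat F n)ᵀ * (Tmat F n x y)⁻¹ * Rmat F n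
      = ((-1 : F) ^ n * (x * y / (x + y))) •
          Matrix.of (fun i j => uvec F n i * uvec F n j) := by
    rw [← Rt_mul_W, Matrix.mul_assoc]
    congr 1
    rw [← Tmat_mul_W F n hn x y hxy, Matrix.nonsing_inv_mul_cancel_left _ _ hdet]
  refine ⟨hU, hmain, ?_⟩
  rw [hmain]
  have : ((-1 : F) ^ n * (x * y / (x + y))) • Matrix.of (fun i j => uvec F n i * uvec F n j)
      = Matrix.vecMulVec (((-1 : F) ^ n * (x * y / (x + y))) • uvec F n) (uvec F n) := by
    ext i j
    simp [Matrix.vecMulVec_apply, mul_assoc]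
  rw [this]
  exact Matrix.rank_vecMulVec_le _ _
end

section
/- Let n : ℕ and consider the multiparameter Hückel matrix H_n(x_0,…,x_n, y_0,…,y_n) over the multivariate polynomial ring ℤ[x_0,…,x_n,y_0,…,y_n]. Then every coefficient of the polynomial det H_n(x,y) is a perfect square: for every monomial exponent vector d there exists an integer c with coeff_d(det H_n) = c². -/
open Matrix

/-- Vertices of the graphene triangle with rows `0, …, n`: row `m` has `2m+1` atoms. -/
abbrev TriIdx (n : ℕ) := (m : Fin (n+1)) × Fin (2*m.val+1)

/-- The Hückel matrix of the graphene triangle, with row-dependent boundary parameters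
`x m`, `y m`. -/
def Huckel (R : Type*) [CommRing R] (n : ℕ) (x y : Fin (n+1) → R) :
    Matrix (TriIdx n) (TriIdx n) R :=
  Matrix.of fun p q =>
    if p.1 = q.1 ∧ (p.2.val + 1 = q.2.val ∨ q.2.val + 1 = p.2.val) then 1
    else if p.1.val + 1 = q.1.val ∧ Even p.2.val ∧ q.2.val = p.2.val + 1 then 1
    else if q.1.val + 1 = p.1.val ∧ Even q.2.val ∧ p.2.val = q.2.val + 1 then 1
    else if 1 ≤ p.1.val ∧ p.1 = q.1 ∧ p.2.val = 0 ∧ q.2.val = 2*p.1.val then y p.1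
    else if 1 ≤ p.1.val ∧ p.1 = q.1 ∧ p.2.val = 2*p.1.val ∧ q.2.val = 0 then x p.1
    else if p.1.val = 0 ∧ q.1.val = 0 then x p.1 + y p.1
    else 0

namespace HuckelAux

/-- Expansion of `det (W + diagonal D)` into principal minors. -/
lemma det_add_diag {V R : Type*} [Fintype V] [DecidableEq V] [CommRing R]
    (W : Matrix V V R) (D : V → R) :
    (W + Matrix.diagonal D).det =
      ∑ t : Finset V, (∏ v ∈ tᶜ, D v) *
        (W.submatrix (Subtype.val : t → V) (Subtype.val : t → V)).det := by
  let F := (Matrix.detRowAlternating : (V → R) [⋀^V]→ₗ[R] R)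
  have h0 : (W + Matrix.diagonal D).det =
      F ((fun i => W i) + (fun i => Matrix.diagonal D i)) := rfl
  rw [h0, F.map_add_univ]
  refine Finset.sum_congr rfl fun t _ => ?_
  have h1 : t.piecewise (fun i => W i) (fun i => Matrix.diagonal D i) =
      fun i => (if i ∈ tᶜ then D i else 1) •
        (t.piecewise W.row (1 : Matrix V V R).row) i := by
    funext i j
    by_cases h : i ∈ t
    · simp [h, Finset.piecewise, Matrix.row]
    · by_cases hij : i = j
      · subst hij; simp [h, Finset.piecewise, Matrix.row]
      · simp [h, Finset.piecewise, Matrix.row, hij]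
  rw [h1, F.map_smul_univ, smul_eq_mul]
  congr 1
  · rw [Finset.prod_ite_mem, Finset.univ_inter]
  · exact Matrix.det_piecewise_one_eq_submatrix_det W t

/-- Determinant of a symmetric bipartite integer matrix. -/
lemma det_bip {T : Type*} [Fintype T] [DecidableEq T] (p : T → Prop) [DecidablePred p]
    (M : Matrix T T ℤ) (hs : ∀ i j, M i j = M j i) (hb : ∀ i j, (p i ↔ p j) → M i j = 0) :
    ∃ c : ℤ, M.det = (-1) ^ (Fintype.card {i // ¬ p i}) * c ^ 2 := by
  by_cases hc : Fintype.card {i // p i} = Fintype.card {i // ¬ p i}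
  · let e := Fintype.equivOfCardEq hc
    let P : Matrix {i // ¬ p i} {i // ¬ p i} ℤ := fun i j => M (e.symm i) j
    let f : {i // ¬ p i} ⊕ {i // ¬ p i} ≃ T :=
      (Equiv.sumCongr e.symm (Equiv.refl _)).trans (Equiv.sumCompl p)
    refine ⟨P.det, ?_⟩
    rw [← Matrix.det_submatrix_equiv_self f M]
    have : M.submatrix f f = Matrix.fromBlocks 0 P Pᵀ 0 := by
      ext (i | i) (j | j)
      · simp only [Matrix.submatrix_apply, Matrix.fromBlocks_apply₁₁, Matrix.zero_apply]
        apply hb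
        simp [f, (e.symm i).2, (e.symm j).2]
      · rfl
      · exact hs _ _
      · simp only [Matrix.submatrix_apply, Matrix.fromBlocks_apply₂₂, Matrix.zero_apply]
        apply hb
        simp [f, i.2, j.2]
    rw [this]
    have h2 : Matrix.fromBlocks 0 P Pᵀ 0 =
        Matrix.fromBlocks P 0 0 (Pᵀ) * Matrix.fromBlocks 0 1 1 0 := by
      simp [Matrix.fromBlocks_multiply]
    have h3 : (Matrix.fromBlocks 0 1 1 0 :
        Matrix ({i // ¬ p i} ⊕ {i // ¬ p i}) ({i // ¬ p i} ⊕ {i // ¬ p i}) ℤ).det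
        = (-1) ^ (Fintype.card {i // ¬ p i}) := by
      have h4 : (Matrix.fromBlocks 0 1 1 0 :
        Matrix ({i // ¬ p i} ⊕ {i // ¬ p i}) ({i // ¬ p i} ⊕ {i // ¬ p i}) ℤ) =
        Matrix.fromBlocks 1 0 1 1 * Matrix.fromBlocks 1 1 0 (-1) * Matrix.fromBlocks 1 0 (-1) 1 := by
        simp [Matrix.fromBlocks_multiply]
      rw [h4, Matrix.det_mul, Matrix.det_mul, Matrix.det_fromBlocks_zero₁₂,
        Matrix.det_fromBlocks_zero₁₂, Matrix.det_fromBlocks_zero₂₁, Matrix.det_neg]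
      simp
    rw [h2, Matrix.det_mul, h3, Matrix.det_fromBlocks_zero₁₂, Matrix.det_transpose]
    ring
  · refine ⟨0, ?_⟩
    rw [Matrix.det_apply]
    simp only [ne_eq, OfNat.ofNat_ne_zero, not_false_eq_true, zero_pow, mul_zero]
    refine Finset.sum_eq_zero fun σ _ => ?_
    by_contra hne
    apply hc
    have hσ : ∀ i, p i ↔ ¬ p (σ i) := by
      intro i
      have h1 : ∏ i, M (σ i) i ≠ 0 := fun h => hne (by rw [h, smul_zero])
      have h2 := Finset.prod_ne_zero_iff.1 h1 i (Finset.mem_univ _)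
      have h3 := mt (hb (σ i) i) h2
      tauto
    exact Fintype.card_congr (σ.subtypeEquiv hσ)

section Poly
open MvPolynomial

lemma coeff_prod_fiber {ι V : Type*} [Fintype ι] [DecidableEq ι] [DecidableEq V]
    (pos : ι → V) (s : Finset V) : ∀ d : ι →₀ ℕ,
    (coeff d (∏ v ∈ s, ∑ i with pos i = v, (X i : MvPolynomial ι ℤ)) = 0 ∨
      coeff d (∏ v ∈ s, ∑ i with pos i = v, (X i : MvPolynomial ι ℤ)) = 1 ∧
        s = d.support.image pos) := by
  induction s using Finset.induction_on with
  | empty =>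
    intro d
    by_cases h : d = 0
    · subst h; right; simp
    · left; simp [coeff_one, Ne.symm h]
  | insert a s ha ih =>
    intro d
    rw [Finset.prod_insert ha, Finset.sum_mul, coeff_sum]
    by_cases hall : ∀ i ∈ Finset.univ.filter (fun i => pos i = a), coeff d
      (X i * ∏ v ∈ s, ∑ i with pos i = v, (X i : MvPolynomial ι ℤ)) = 0
    · left; exact Finset.sum_eq_zero hall
    · right
      push Not at hall
      obtain ⟨i, hi, hne⟩ := hall
      have hia : pos i = a := by simpa using hi
      -- information from a nonzero term
      have key : ∀ j, coeff d (X j * ∏ v ∈ s, ∑ i with pos i = v, (X i : MvPolynomial ι ℤ)) ≠ 0 →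
          j ∈ d.support ∧
          coeff d (X j * ∏ v ∈ s, ∑ i with pos i = v, (X i : MvPolynomial ι ℤ)) = 1 ∧
          s = (d - Finsupp.single j 1).support.image pos := by
        intro j hj
        rw [coeff_X_mul'] at hj ⊢
        split_ifs at hj ⊢ with h
        · rcases ih (d - Finsupp.single j 1) with h0 | h1
          · exact absurd h0 hj
          · exact ⟨h, h1⟩
        · exact absurd rfl hj
      obtain ⟨k1, k2, k3⟩ := key i hne
      have hmem : ∀ j, j ∈ d.support → j ≠ i → j ∈ (d - Finsupp.single i 1).support := by
        intro j hj hji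
        simp only [Finsupp.mem_support_iff, Finsupp.tsub_apply] at hj ⊢
        rw [Finsupp.single_eq_of_ne hji]
        simpa using hj
      refine ⟨?_, ?_⟩
      · rw [Finset.sum_eq_single i, k2]
        · intro j hj hji
          by_contra hjne
          obtain ⟨l1, -, -⟩ := key j hjne
          apply ha
          have hja : pos j = a := by simpa using hj
          rw [k3, ← hja]
          exact Finset.mem_image_of_mem _ (hmem j l1 hji)
        · intro h; exact absurd hi h
      · ext v
        rw [Finset.mem_insert, Finset.mem_image]
        constructor
        · rintro (rfl | hv)
          · exact ⟨i, k1, hia⟩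
          · rw [k3, Finset.mem_image] at hv
            obtain ⟨j, hj, rfl⟩ := hv
            refine ⟨j, ?_, rfl⟩
            simp only [Finsupp.mem_support_iff, Finsupp.tsub_apply] at hj ⊢
            omega
        · rintro ⟨j, hj, rfl⟩
          by_cases hji : j = i
          · left; rw [hji, hia]
          · right; rw [k3]; exact Finset.mem_image_of_mem _ (hmem j hj hji)

/-- Abstract form of the theorem. -/
lemma coeff_det_abstract {ι V : Type*} [Fintype ι] [DecidableEq ι] [Fintype V] [DecidableEq V]
    (pos : ι → V) (p : V → Prop) [DecidablePred p] (hpos : ∀ i, p (pos i))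
    (W : Matrix V V ℤ) (hs : ∀ i j, W i j = W j i) (hb : ∀ i j, (p i ↔ p j) → W i j = 0)
    (d : ι →₀ ℕ) :
    ∃ c : ℤ, coeff d (W.map (C : ℤ →+* MvPolynomial ι ℤ) +
      Matrix.diagonal (fun v => ∑ i with pos i = v, (X i : MvPolynomial ι ℤ))).det =
      (-1) ^ (Fintype.card {v // ¬ p v}) * c ^ 2 := by
  rw [det_add_diag, coeff_sum]
  have hterm : ∀ t : Finset V, coeff d ((∏ v ∈ tᶜ, ∑ i with pos i = v, (X i : MvPolynomial ι ℤ)) *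
      ((W.map (C : ℤ →+* MvPolynomial ι ℤ)).submatrix
        (Subtype.val : t → V) (Subtype.val : t → V)).det) =
      coeff d (∏ v ∈ tᶜ, ∑ i with pos i = v, (X i : MvPolynomial ι ℤ)) *
        (W.submatrix (Subtype.val : t → V) (Subtype.val : t → V)).det := by
    intro t
    rw [Matrix.submatrix_map]
    have := (RingHom.map_det (C : ℤ →+* MvPolynomial ι ℤ)
      (W.submatrix (Subtype.val : t → V) (Subtype.val : t → V))).symm
    rw [RingHom.mapMatrix_apply] at this
    rw [this, mul_comm, coeff_C_mul, mul_comm]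
  simp_rw [hterm]
  rw [Finset.sum_eq_single ((d.support.image pos)ᶜ)]
  · rcases coeff_prod_fiber pos ((d.support.image pos)ᶜᶜ) d with h | ⟨h, -⟩
    · exact ⟨0, by rw [h]; simp⟩
    · rw [h, one_mul]
      set t := (d.support.image pos)ᶜ with ht
      obtain ⟨c, hc⟩ := det_bip (fun v : t => p v.1)
        (W.submatrix (Subtype.val : t → V) (Subtype.val : t → V))
        (fun i j => hs _ _) (fun i j h => hb _ _ h)
      refine ⟨c, ?_⟩
      rw [hc]
      congr 2
      refine Fintype.card_congr
        ⟨fun v => ⟨v.1.1, v.2⟩, fun v => ⟨⟨v.1, ?_⟩, v.2⟩, fun v => rfl, fun v => rfl⟩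
      rw [ht, Finset.mem_compl, Finset.mem_image]
      rintro ⟨i, -, hi⟩
      exact v.2 (hi ▸ hpos i)
  · intro t _ ht
    rcases coeff_prod_fiber pos tᶜ d with h | ⟨-, h⟩
    · rw [h, zero_mul]
    · exact absurd (by rw [← h, compl_compl]) ht
  · intro h; exact absurd (Finset.mem_univ _) h

end Poly

/-- Mirror symmetry. -/
def mir (n : ℕ) : Equiv.Perm (TriIdx n) :=
  Equiv.sigmaCongrRight fun _ => Fin.revPerm

lemma mir_fst (n : ℕ) (v : TriIdx n) : (mir n v).1 = v.1 := rfl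

lemma mir_snd (n : ℕ) (v : TriIdx n) : (mir n v).2.val = 2 * v.1.val - v.2.val := by
  change (Fin.rev v.2).val = _
  rw [Fin.val_rev]; omega

lemma tri_ext {n : ℕ} {v w : TriIdx n} (h1 : v.1.val = w.1.val) (h2 : v.2.val = w.2.val) :
    v = w := by
  obtain ⟨a, b⟩ := v
  obtain ⟨a', b'⟩ := w
  have : a = a' := Fin.ext h1
  subst this
  have : b = b' := Fin.ext h2
  subst this
  rfl

lemma card_odd (n : ℕ) :
    Fintype.card {v : TriIdx n // ¬ Even v.2.val} = ∑ m : Fin (n+1), m.val := by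
  have e : {v : TriIdx n // ¬ Even v.2.val} ≃ (m : Fin (n+1)) × Fin m.val :=
    { toFun := fun v => ⟨v.1.1, ⟨v.1.2.val / 2, by
        have := v.2; have := v.1.2.2; rw [Nat.even_iff] at *; omega⟩⟩
      invFun := fun w => ⟨⟨w.1, ⟨2 * w.2.val + 1, by have := w.2.2; omega⟩⟩, by
        simp⟩
      left_inv := by
        rintro ⟨v, hv⟩
        apply Subtype.ext
        apply tri_ext
        · rfl
        · change 2 * (v.2.val / 2) + 1 = v.2.val
          rw [Nat.even_iff] at hv; omega
      right_inv := by
        rintro ⟨m, j⟩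
        have : (2 * j.val + 1) / 2 = j.val := by omega
        simp [this] }
  rw [Fintype.card_congr e, Fintype.card_sigma]
  simp

lemma sign_mir (n : ℕ) :
    Equiv.Perm.sign (mir n) = (-1) ^ (Fintype.card {v : TriIdx n // ¬ Even v.2.val}) := by
  have h2 : (mir n) ^ 2 = 1 := by
    ext1 v
    rw [pow_two, Equiv.Perm.mul_apply, Equiv.Perm.one_apply]
    apply tri_ext
    · rfl
    · have := v.2.2
      rw [mir_snd, mir_snd, mir_fst]; omega
  rw [Equiv.Perm.sign_of_pow_two_eq_one h2, card_odd]
  have hfix : Fintype.card (Function.fixedPoints (mir n)) = n + 1 := by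
    have e : Function.fixedPoints (mir n) ≃ Fin (n+1) :=
      { toFun := fun v => v.1.1
        invFun := fun m => ⟨⟨m, ⟨m.val, by omega⟩⟩, by
          apply tri_ext
          · rfl
          · rw [mir_snd]; dsimp only; omega⟩
        left_inv := by
          rintro ⟨v, hv⟩
          apply Subtype.ext
          apply tri_ext
          · rfl
          · have h := mir_snd n v
            have hv' : mir n v = v := hv
            rw [hv'] at h
            have := v.2.2
            dsimp only
            omega
        right_inv := fun m => rfl }
    rw [Fintype.card_congr e, Fintype.card_fin]
  have hcard : Fintype.card (TriIdx n) = 2 * (∑ m : Fin (n+1), m.val) + (n + 1) := by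
    rw [Fintype.card_sigma]
    simp [Finset.sum_add_distrib, Finset.mul_sum]
  rw [hfix, hcard]
  congr 1
  omega

/-- Boundary position of each variable. -/
def pos (n : ℕ) : Fin (n+1) ⊕ Fin (n+1) → TriIdx n
  | Sum.inl m => ⟨m, ⟨2 * m.val, by omega⟩⟩
  | Sum.inr m => ⟨m, ⟨0, by omega⟩⟩

/-- Adjacency in the graphene triangle. -/
def adj {n : ℕ} (p q : TriIdx n) : Prop :=
  (p.1.val = q.1.val ∧ (p.2.val + 1 = q.2.val ∨ q.2.val + 1 = p.2.val)) ∨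
  (p.1.val + 1 = q.1.val ∧ p.2.val % 2 = 0 ∧ q.2.val = p.2.val + 1) ∨
  (q.1.val + 1 = p.1.val ∧ q.2.val % 2 = 0 ∧ p.2.val = q.2.val + 1)

instance {n : ℕ} (p q : TriIdx n) : Decidable (adj p q) := by unfold adj; infer_instance

/-- The mirrored adjacency matrix. -/
def W (n : ℕ) : Matrix (TriIdx n) (TriIdx n) ℤ :=
  fun p q => if adj p (mir n q) then 1 else 0

lemma W_symm (n : ℕ) (p q : TriIdx n) : W n p q = W n q p := by
  unfold W
  congr 1
  have := p.2.2
  have := q.2.2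
  unfold adj
  rw [mir_snd, mir_snd, mir_fst, mir_fst]
  apply propext
  omega

lemma W_bip (n : ℕ) (p q : TriIdx n) (h : Even p.2.val ↔ Even q.2.val) : W n p q = 0 := by
  unfold W
  rw [if_neg]
  have := p.2.2
  have := q.2.2
  unfold adj
  rw [mir_snd, mir_fst]
  rw [Nat.even_iff, Nat.even_iff] at h
  omega

lemma diag_sum (n : ℕ) (v : TriIdx n) :
    (∑ i with pos n i = v, (MvPolynomial.X i : MvPolynomial (Fin (n+1) ⊕ Fin (n+1)) ℤ)) =
      (if v.2.val = 2 * v.1.val then MvPolynomial.X (Sum.inl v.1) else 0) +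
      (if v.2.val = 0 then MvPolynomial.X (Sum.inr v.1) else 0) := by
  rw [Finset.sum_filter, Fintype.sum_sum_type]
  congr 1
  · rw [Finset.sum_eq_single v.1]
    · congr 1
      apply propext
      constructor
      · intro h; rw [← h]; rfl
      · intro h; exact tri_ext rfl h.symm
    · intro m _ hm
      rw [if_neg]
      rintro rfl
      exact hm rfl
    · intro h; exact absurd (Finset.mem_univ _) h
  · rw [Finset.sum_eq_single v.1]
    · congr 1
      apply propext
      constructor
      · intro h; rw [← h]; rfl
      · intro h; exact tri_ext rfl h.symm
    · intro m _ hm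
      rw [if_neg]
      rintro rfl
      exact hm rfl
    · intro h; exact absurd (Finset.mem_univ _) h

set_option maxHeartbeats 4000000 in
lemma huckel_mir (n : ℕ) :
    (Huckel (MvPolynomial (Fin (n+1) ⊕ Fin (n+1)) ℤ) n
            (fun m => MvPolynomial.X (Sum.inl m))
            (fun m => MvPolynomial.X (Sum.inr m))).submatrix id (mir n) =
      (W n).map (MvPolynomial.C : ℤ →+* MvPolynomial (Fin (n+1) ⊕ Fin (n+1)) ℤ) +
      Matrix.diagonal (fun v => ∑ i with pos n i = v,
        (MvPolynomial.X i : MvPolynomial (Fin (n+1) ⊕ Fin (n+1)) ℤ)) := by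
  ext1 p q
  have hp := p.2.2
  have hq := q.2.2
  rw [Matrix.submatrix_apply, Matrix.add_apply, Matrix.map_apply, Matrix.diagonal_apply, diag_sum]
  simp only [Huckel, Matrix.of_apply, id, W, Fin.ext_iff, Nat.even_iff]
  have h1 : (mir n q).1.val = q.1.val := by rw [mir_fst]
  have h2 := mir_snd n q
  generalize mir n q = r at h1 h2 ⊢
  by_cases hpq : p = q
  · subst hpq
    rw [if_pos rfl]
    by_cases ha : adj p r
    · rw [if_pos ha]
      unfold adj at ha
      split_ifs <;> first | omega | simp
    · rw [if_neg ha]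
      unfold adj at ha
      split_ifs <;> first | omega | simp
  · have hne : ¬ (p.1.val = q.1.val ∧ p.2.val = q.2.val) := fun h => hpq (tri_ext h.1 h.2)
    rw [if_neg hpq]
    by_cases ha : adj p r
    · rw [if_pos ha]
      unfold adj at ha
      split_ifs <;> first | omega | simp
    · rw [if_neg ha]
      unfold adj at ha
      split_ifs <;> first | omega | simp

end HuckelAux

/-- Every coefficient of the determinant of the multiparameter Hückel matrix, as a
multivariate polynomial in the variables `x_0, …, x_n, y_0, …, y_n`, is a perfect square. -/
theorem det_Huckel_coeff_square (n : ℕ) (d : (Fin (n+1) ⊕ Fin (n+1)) →₀ ℕ) :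
    ∃ c : ℤ,
      MvPolynomial.coeff d
        ((Huckel (MvPolynomial (Fin (n+1) ⊕ Fin (n+1)) ℤ) n
            (fun m => MvPolynomial.X (Sum.inl m))
            (fun m => MvPolynomial.X (Sum.inr m))).det)
        = c ^ 2 := by
  obtain ⟨c, hc⟩ := HuckelAux.coeff_det_abstract (HuckelAux.pos n)
    (fun v : TriIdx n => Even v.2.val) (by rintro (m | m) <;> simp [HuckelAux.pos])
    (HuckelAux.W n) (HuckelAux.W_symm n) (HuckelAux.W_bip n) d
  refine ⟨c, ?_⟩
  rw [← HuckelAux.huckel_mir, Matrix.det_permute', HuckelAux.sign_mir] at hc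
  generalize Fintype.card {v : TriIdx n // ¬ Even v.2.val} = k at hc
  rcases Nat.even_or_odd k with h | h
  · simpa [h.neg_one_pow] using hc
  · simpa [h.neg_one_pow] using hc
end

section
/- Let R be a commutative ring, 1 ≤ k < n natural numbers, and x_k,…,x_n, y_k,…,y_n ∈ R. Then det H_{k,n}(x,y) = (x_n + y_n) · det H_{k,n−1}(x',y') − x_n y_n · det H'_{k,n}(x',y'), where H_{k,n−1}(x',y') is the trapezium Hückel matrix with rows k,…,n−1 and parameters x_k,…,x_{n−1}, y_k,…,y_{n−1}, and H'_{k,n} is the matrix obtained from H_{k,n} by deleting the two rows and two columns indexed by the vertices (n,0) and (n,2n) (the row-end vertices carrying x_n and y_n). -/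
open Matrix

/-- Vertices of the honeycomb trapezium with rows `k, …, n`: row `m` has `2m+1` atoms. -/
abbrev TrapIdx (k n : ℕ) := {p : (m : Fin (n+1)) × Fin (2*m.val+1) // k ≤ p.1.val}

/-- The Hückel matrix of the honeycomb trapezium with rows `k, …, n` and row-dependent
boundary parameters `x m`, `y m`. -/
def HuckelTrap (R : Type*) [CommRing R] (k n : ℕ) (x y : Fin (n+1) → R) :
    Matrix (TrapIdx k n) (TrapIdx k n) R :=
  Matrix.of fun P Q =>
    if P.1.1 = Q.1.1 ∧ (P.1.2.val + 1 = Q.1.2.val ∨ Q.1.2.val + 1 = P.1.2.val) then 1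
    else if P.1.1.val + 1 = Q.1.1.val ∧ Even P.1.2.val ∧ Q.1.2.val = P.1.2.val + 1 then 1
    else if Q.1.1.val + 1 = P.1.1.val ∧ Even Q.1.2.val ∧ P.1.2.val = Q.1.2.val + 1 then 1
    else if P.1.1 = Q.1.1 ∧ P.1.2.val = 0 ∧ Q.1.2.val = 2*P.1.1.val then y P.1.1
    else if P.1.1 = Q.1.1 ∧ P.1.2.val = 2*P.1.1.val ∧ Q.1.2.val = 0 then x P.1.1
    else 0

/-- Expansion along a row and column with two nonzero entries each. -/
lemma aux_expand {ι R : Type*} [Fintype ι] [DecidableEq ι] [CommRing R] (M : Matrix ι ι R)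
    (a b : ι) (hab : a ≠ b) (s x y : R)
    (hr : M a = Pi.single a s + Pi.single b y)
    (hc : ∀ i, M i a = (Pi.single a s + Pi.single b x : ι → R) i) :
    M.det = s * (M.submatrix (fun P : {P : ι // P ≠ a} => P.1) (fun P => P.1)).det
      - x * y * (M.submatrix (fun P : {P : ι // P ≠ a ∧ P ≠ b} => P.1) (fun P => P.1)).det := by
  have key : ∀ (M' : Matrix ι ι R), (∀ j, j ≠ a → M' a j = 0) →
      M'.det = M' a a * (M'.submatrix (fun P : {P : ι // P ≠ a} => P.1) (fun P => P.1)).det := by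
    intro M' h
    rw [Matrix.twoBlockTriangular_det' M' (fun i => i = a)]
    · congr 1
      let u : Unique {i // i = a} := ⟨⟨⟨a, rfl⟩⟩, fun x => Subtype.ext x.2⟩
      convert Matrix.det_unique (toSquareBlockProp M' fun i => i = a)
      rfl
    · intro i hi j hj
      subst hi
      exact h j hj
  have h1 : M.det = (M.updateRow a (s • Pi.single a 1)).det
      + (M.updateRow a (y • Pi.single b 1)).det := by
    rw [← Matrix.det_updateRow_add]
    congr 1
    conv_lhs => rw [← Matrix.updateRow_eq_self M a, hr]
    congr 1
    simp [← Pi.single_smul]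
  rw [h1, Matrix.det_updateRow_smul, Matrix.det_updateRow_smul]
  have h2 : (M.updateRow a (Pi.single a 1)).det =
      (M.submatrix (fun P : {P : ι // P ≠ a} => P.1) (fun P => P.1)).det := by
    rw [key]
    · simp only [Matrix.updateRow_self, Pi.single_eq_same, one_mul]
      congr 1
      ext i j
      simp [Matrix.updateRow_ne i.2]
    · intro j hj
      simp [hj]
  have h3 : (M.updateRow a (Pi.single b 1)).det =
      - (x * (M.submatrix (fun P : {P : ι // P ≠ a ∧ P ≠ b} => P.1) (fun P => P.1)).det) := by
    have hs := Matrix.det_permute' (Equiv.swap a b) (M.updateRow a (Pi.single b 1))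
    rw [Equiv.Perm.sign_swap hab] at hs
    have hs' : (M.updateRow a (Pi.single b 1)).det =
      - ((M.updateRow a (Pi.single b 1)).submatrix id (Equiv.swap a b)).det := by
      rw [hs]; simp
    rw [hs', key]
    · simp only [Matrix.submatrix_apply, id, Matrix.updateRow_self, Equiv.swap_apply_left,
        Pi.single_eq_same, one_mul, Matrix.submatrix_submatrix]
      congr 1
      rw [Matrix.twoBlockTriangular_det _ (fun i => i.1 = b)]
      · congr 1
        · let u : Unique {i : {P : ι // P ≠ a} // i.1 = b} :=
            ⟨⟨⟨⟨b, hab.symm⟩, rfl⟩⟩, fun x => Subtype.ext (Subtype.ext x.2)⟩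
          rw [Matrix.det_unique]
          change (M.updateRow a (Pi.single b 1)) b (Equiv.swap a b b) = x
          rw [Matrix.updateRow_ne hab.symm, Equiv.swap_apply_right, hc]
          simp [hab.symm]
        · let e : {i : {P : ι // P ≠ a} // ¬ i.1 = b} ≃ {P : ι // P ≠ a ∧ P ≠ b} :=
            Equiv.subtypeSubtypeEquivSubtypeInter (fun P => P ≠ a) (fun P => P ≠ b)
          rw [← Matrix.det_submatrix_equiv_self e]
          congr 1
          ext i j
          change (M.updateRow a (Pi.single b 1)) i.1.1 (Equiv.swap a b j.1.1) = M i.1.1 j.1.1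
          rw [Matrix.updateRow_ne i.1.2, Equiv.swap_apply_of_ne_of_ne j.1.2 j.2]
      · intro i hi j hj
        change (M.updateRow a (Pi.single b 1)) i.1 (Equiv.swap a b j.1) = 0
        rw [hj, Matrix.updateRow_ne i.2, Equiv.swap_apply_right, hc]
        simp [i.2, hi]
    · intro j hj
      by_cases h : j = b
      · subst h; simp [hab]
      · simp [Equiv.swap_apply_of_ne_of_ne hj h, h]
  rw [h2, h3]
  ring

/-- Sign of the block swap. -/
lemma aux_swap {R : Type*} [CommRing R] (N : ℕ) :
    (Matrix.fromBlocks 0 1 1 0 : Matrix (Fin N ⊕ Fin N) (Fin N ⊕ Fin N) R).det = (-1) ^ N := by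
  have h : (Matrix.fromBlocks 1 1 0 1 : Matrix (Fin N ⊕ Fin N) (Fin N ⊕ Fin N) R) *
      Matrix.fromBlocks 0 1 1 0 = Matrix.fromBlocks 1 1 1 0 := by
    simp [Matrix.fromBlocks_multiply]
  have h' := congrArg Matrix.det h
  rw [Matrix.det_mul, Matrix.det_fromBlocks_zero₂₁, Matrix.det_fromBlocks_one₁₁] at h'
  simpa [Matrix.det_neg] using h'

lemma aux_blocks {U R : Type*} [Fintype U] [DecidableEq U] [CommRing R] (N : ℕ)
    (T T' : Matrix (Fin N) (Fin N) R) (hT : T.det = 1) (hT' : T'.det = 1)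
    (B : Matrix (Fin N) U R) (C : Matrix U (Fin N) R) (H : Matrix U U R) :
    (Matrix.fromBlocks (Matrix.fromBlocks 0 T T' 0) (Matrix.fromRows 0 B)
      (Matrix.fromCols 0 C) H).det = (-1) ^ N * H.det := by
  have h : (Matrix.fromBlocks (Matrix.fromBlocks 0 1 1 0) 0 0 1 :
        Matrix ((Fin N ⊕ Fin N) ⊕ U) ((Fin N ⊕ Fin N) ⊕ U) R) *
      (Matrix.fromBlocks (Matrix.fromBlocks 0 T T' 0) (Matrix.fromRows 0 B)
      (Matrix.fromCols 0 C) H) = (Matrix.fromBlocks T' (Matrix.fromCols 0 B) 0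
        (Matrix.fromBlocks T 0 C H)).submatrix (Equiv.sumAssoc _ _ _) (Equiv.sumAssoc _ _ _) := by
    rw [Matrix.fromBlocks_multiply, Matrix.fromBlocks_multiply, Matrix.fromBlocks_mul_fromRows]
    ext ((i | i) | i) ((j | j) | j) <;> simp
  have h' := congrArg Matrix.det h
  rw [Matrix.det_mul, Matrix.det_fromBlocks_zero₂₁, Matrix.det_submatrix_equiv_self,
    Matrix.det_fromBlocks_zero₂₁, Matrix.det_fromBlocks_zero₁₂, aux_swap, hT, hT'] at h'
  simp only [Matrix.det_one, one_mul, mul_one] at h'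
  rw [← h', ← mul_assoc, ← mul_pow]
  simp

lemma aux_alt {R : Type*} [CommRing R] (N : ℕ) (j : Fin N) :
    ∑ i : Fin (N + 1), (-1 : R) ^ i.val * (if i.val = j.val ∨ i.val = j.val + 1 then 1 else 0)
      = 0 := by
  rw [Finset.sum_eq_add_of_mem j.castSucc j.succ (Finset.mem_univ _) (Finset.mem_univ _)]
  · simp [pow_succ]
  · simp [Fin.ext_iff, -Fin.val_eq_zero_iff]
  · intro c _ hc
    simp only [ne_eq, Fin.ext_iff, Fin.val_castSucc, Fin.val_succ] at hc
    simp [hc]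

lemma aux_generic {U R : Type*} [Fintype U] [DecidableEq U] [CommRing R] (N : ℕ) (hN : 0 < N)
    (x y : R) (H : Matrix U U R)
    (A : Matrix (Fin (N + 1) ⊕ (Fin N ⊕ U)) (Fin (N + 1) ⊕ (Fin N ⊕ U)) R)
    (hEE : ∀ i j, A (.inl i) (.inl j) =
      (if i = 0 ∧ j = Fin.last N then y else 0) + (if i = Fin.last N ∧ j = 0 then x else 0))
    (hEO : ∀ i j, A (.inl i) (.inr (.inl j)) =
      if i.val = j.val ∨ i.val = j.val + 1 then 1 else 0)
    (hOE : ∀ i j, A (.inr (.inl j)) (.inl i) =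
      if i.val = j.val ∨ i.val = j.val + 1 then 1 else 0)
    (hEU : ∀ i u, A (.inl i) (.inr (.inr u)) = 0)
    (hUE : ∀ i u, A (.inr (.inr u)) (.inl i) = 0)
    (hOO : ∀ i j, A (.inr (.inl i)) (.inr (.inl j)) = 0)
    (hUU : ∀ u v, A (.inr (.inr u)) (.inr (.inr v)) = H u v) :
    A.det = (x + y) * H.det - x * y *
      (A.submatrix (fun P : {P : Fin (N + 1) ⊕ (Fin N ⊕ U) //
        P ≠ .inl 0 ∧ P ≠ .inl (Fin.last N)} => P.1) (fun P => P.1)).det := by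
  have h0N : (0 : Fin (N + 1)) ≠ Fin.last N := by
    simp [Fin.ext_iff]; omega
  let c : Fin (N + 1) ⊕ (Fin N ⊕ U) → R := Sum.elim (fun i => (-1) ^ i.val) (fun _ => 0)
  let a : Fin (N + 1) ⊕ (Fin N ⊕ U) := .inl 0
  let b : Fin (N + 1) ⊕ (Fin N ⊕ U) := .inl (Fin.last N)
  have hab : a ≠ b := fun h => h0N (Sum.inl_injective h)
  have hca : c a = 1 := by simp [c, a]
  have hrow : ∑ P, c P • A P = Pi.single a ((-1) ^ N * x) + Pi.single b y := by
    ext Q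
    rw [Finset.sum_apply, Fintype.sum_sum_type]
    rcases Q with j | j | j
    · simp only [c, Sum.elim_inl, Sum.elim_inr, Pi.smul_apply, smul_eq_mul, zero_mul,
        Finset.sum_const_zero, add_zero, hEE, mul_add, Finset.sum_add_distrib]
      by_cases h0 : j = 0
      · subst h0; simp [h0N, a, b]
      · by_cases h1 : j = Fin.last N
        · subst h1; simp [a, b, h0N.symm]
        · simp [a, b, h0, h1]
    · simpa [c, hEO, a, b] using aux_alt (R := R) N j
    · simp [c, hEU, a, b]
  have hcol : ∀ Q, ∑ P, c P * A Q P =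
      (Pi.single a ((-1) ^ N * y) + Pi.single b x : _ → R) Q := by
    intro Q
    rw [Fintype.sum_sum_type]
    rcases Q with j | j | j
    · simp only [c, Sum.elim_inl, Sum.elim_inr, zero_mul,
        Finset.sum_const_zero, add_zero, hEE, mul_add, Finset.sum_add_distrib]
      by_cases h0 : j = 0
      · subst h0; simp [h0N, a, b]
      · by_cases h1 : j = Fin.last N
        · subst h1; simp [a, b, h0N.symm]
        · simp [a, b, h0, h1]
    · simpa [c, hOE, a, b] using aux_alt (R := R) N j
    · simp [c, hUE, a, b]
  let M1 := A.updateRow a (∑ P, c P • A P)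
  have hM1 : M1.det = A.det := by
    rw [Matrix.det_updateRow_sum, hca, one_smul]
  let M2 := M1.updateCol a (fun Q => ∑ P, c P • M1 Q P)
  have hM2 : M2.det = A.det := by
    have := Matrix.det_updateCol_sum M1 a c
    rw [hca, one_smul, hM1] at this
    exact this
  have hcb : c b = (-1) ^ N := by simp [c, b]
  have hM2a : ∀ Q, M2 Q a =
      (Pi.single a ((-1) ^ N * (x + y)) + Pi.single b x : _ → R) Q := by
    intro Q
    simp only [M2, Matrix.updateCol_self]
    by_cases hQ : Q = a
    · subst hQ
      simp only [M1, Matrix.updateRow_self, hrow, smul_eq_mul, Pi.add_apply, mul_add,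
        Finset.sum_add_distrib]
      simp [Pi.single_apply, hca, hcb, hab]
    · simp only [M1, Matrix.updateRow_ne hQ, smul_eq_mul, hcol]
      simp [Pi.single_apply, hQ]
  have hM2r : M2 a = Pi.single a ((-1) ^ N * (x + y)) + Pi.single b y := by
    ext Q
    by_cases hQ : Q = a
    · rw [hQ, hM2a]; simp [hab]
    · simp only [M2, Matrix.updateCol_ne hQ, M1, Matrix.updateRow_self, hrow]
      simp [Pi.single_apply, hQ]
  have hM2e : ∀ P Q, P ≠ a → Q ≠ a → M2 P Q = A P Q := by
    intro P Q hP hQ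
    simp only [M2, Matrix.updateCol_ne hQ, M1, Matrix.updateRow_ne hP]
  rw [← hM2, aux_expand M2 a b hab _ x y hM2r hM2a]
  have e2 : (M2.submatrix (fun P : {P : Fin (N + 1) ⊕ (Fin N ⊕ U) // P ≠ a ∧ P ≠ b} => P.1)
      (fun P : {P : Fin (N + 1) ⊕ (Fin N ⊕ U) // P ≠ a ∧ P ≠ b} => P.1)) =
      A.submatrix (fun P : {P : Fin (N + 1) ⊕ (Fin N ⊕ U) // P ≠ a ∧ P ≠ b} => P.1)
      (fun P : {P : Fin (N + 1) ⊕ (Fin N ⊕ U) // P ≠ a ∧ P ≠ b} => P.1) := by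
    ext i j
    exact hM2e _ _ i.2.1 j.2.1
  rw [e2]
  have e1 : (M2.submatrix (fun P : {P : Fin (N + 1) ⊕ (Fin N ⊕ U) // P ≠ a} => P.1) (fun P => P.1)).det =
      (-1) ^ N * H.det := by
    let f : (Fin N ⊕ Fin N) ⊕ U → {P : Fin (N + 1) ⊕ (Fin N ⊕ U) // P ≠ a} :=
      Sum.elim (Sum.elim (fun i => ⟨.inl i.succ, by simp [a]⟩)
        (fun i => ⟨.inr (.inl i), by simp [a]⟩)) (fun u => ⟨.inr (.inr u), by simp [a]⟩)
    have hf : Function.Bijective f := by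
      constructor
      · rintro ((i | i) | i) ((j | j) | j) h <;> simpa [f] using h
      · rintro ⟨i | i | i, hi⟩
        · have : i ≠ 0 := fun h => hi (by rw [h])
          obtain ⟨j, rfl⟩ := Fin.exists_succ_eq.2 this
          exact ⟨.inl (.inl j), rfl⟩
        · exact ⟨.inl (.inr i), rfl⟩
        · exact ⟨.inr i, rfl⟩
    let T : Matrix (Fin N) (Fin N) R :=
      Matrix.of fun i j => if i.val + 1 = j.val ∨ i.val = j.val then 1 else 0
    have hT : T.det = 1 := by
      rw [Matrix.det_of_isUpperTriangular]
      · simp [T]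
      · intro i j hij
        have : j.val < i.val := hij
        simp only [T, Matrix.of_apply]
        rw [if_neg]; omega
    rw [← Matrix.det_submatrix_equiv_self (Equiv.ofBijective f hf),
      ← aux_blocks N T Tᵀ hT (by rw [Matrix.det_transpose, hT])
      (Matrix.of fun i u => A (.inr (.inl i)) (.inr (.inr u)))
      (Matrix.of fun u i => A (.inr (.inr u)) (.inr (.inl i))) H]
    congr 1
    ext P Q
    have : ∀ P Q, M2 (f P).1 (f Q).1 = A (f P).1 (f Q).1 := fun P Q => hM2e _ _ (f P).2 (f Q).2
    change M2 (f P).1 (f Q).1 = _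
    rw [this]
    rcases P with (i | i) | i <;> rcases Q with (j | j) | j <;>
      simp [f, hEE, hEO, hOE, hEU, hUE, hOO, hUU, T]
  rw [e1]
  have : ((-1 : R) ^ N) * (-1) ^ N = 1 := by rw [← mul_pow]; simp
  linear_combination ((x + y) * H.det) * this

/-- The recursion for trapezium determinants: `det H_{k,n+1} = (x_{n+1}+y_{n+1}) det H_{k,n}
− x_{n+1} y_{n+1} det H'`, where `H'` is `H_{k,n+1}` with the two rows and columns of the
end vertices `(n+1,0)` and `(n+1,2(n+1))` deleted. (This is the case `1 ≤ k < n` of the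
statement, with `n` replaced by `n+1`.) -/
theorem det_HuckelTrap_recursion (R : Type*) [CommRing R] (k n : ℕ)
    (hk : 1 ≤ k) (hkn : k ≤ n) (x y : Fin (n+2) → R) :
    (HuckelTrap R k (n+1) x y).det
      = (x (Fin.last (n+1)) + y (Fin.last (n+1))) *
          (HuckelTrap R k n (fun m => x m.castSucc) (fun m => y m.castSucc)).det
        - x (Fin.last (n+1)) * y (Fin.last (n+1)) *
          ((HuckelTrap R k (n+1) x y).submatrix
            (fun P : {P : TrapIdx k (n+1) //
                ¬ (P.1.1.val = n+1 ∧ (P.1.2.val = 0 ∨ P.1.2.val = 2*(n+1)))} => P.1)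
            (fun Q : {P : TrapIdx k (n+1) //
                ¬ (P.1.1.val = n+1 ∧ (P.1.2.val = 0 ∨ P.1.2.val = 2*(n+1)))} => Q.1)).det := by
  let f : Fin (n + 1 + 1) ⊕ (Fin (n + 1) ⊕ TrapIdx k n) → TrapIdx k (n + 1) :=
    Sum.elim (fun i => ⟨⟨Fin.last (n + 1), ⟨2 * i.val, by simp; omega⟩⟩, by simp; omega⟩)
      (Sum.elim (fun i => ⟨⟨Fin.last (n + 1), ⟨2 * i.val + 1, by simp; omega⟩⟩, by simp; omega⟩)
        (fun p => ⟨⟨p.1.1.castSucc, p.1.2⟩, p.2⟩))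
  have hne : ∀ p : Fin (n + 1), Fin.last (n + 1) ≠ p.castSucc := fun p h => by
    have := congrArg Fin.val h
    simp at this
    omega
  have hf : Function.Bijective f := by
    constructor
    · rintro (i | i | ⟨⟨p, i⟩, hi⟩) (j | j | ⟨⟨q, j⟩, hj⟩) h
      · simp [f] at h; simp [Fin.ext_iff]; omega
      · simp [f] at h; omega
      · exact absurd (congrArg (fun z => z.1.1) h) (hne q)
      · simp [f] at h; omega
      · simp [f] at h; simp [Fin.ext_iff]; omega
      · exact absurd (congrArg (fun z => z.1.1) h) (hne q)
      · exact absurd (congrArg (fun z => z.1.1) h).symm (hne p)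
      · exact absurd (congrArg (fun z => z.1.1) h).symm (hne p)
      · have h1 : p.castSucc = q.castSucc := congrArg (fun z => z.1.1) h
        have h1 := Fin.castSucc_injective _ h1
        subst h1
        have h2 : i.val = j.val := congrArg (fun z => z.1.2.val) h
        have h2 := Fin.ext h2
        subst h2
        rfl
    · rintro ⟨⟨p, i⟩, hi⟩
      induction p using Fin.lastCases with
      | last =>
        have hi2 : i.val < 2 * (n + 1) + 1 := i.2
        rcases Nat.even_or_odd' i.val with ⟨c, hc | hc⟩
        · exact ⟨.inl ⟨c, by omega⟩, Subtype.ext (by simp [f, Fin.ext_iff, hc])⟩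
        · exact ⟨.inr (.inl ⟨c, by omega⟩), Subtype.ext (by simp [f, Fin.ext_iff, hc])⟩
      | cast p => exact ⟨.inr (.inr ⟨⟨p, i⟩, hi⟩), rfl⟩
  let e := Equiv.ofBijective f hf
  have g := aux_generic (n + 1) (Nat.succ_pos n) (x (Fin.last (n+1))) (y (Fin.last (n+1)))
    (HuckelTrap R k n (fun m => x m.castSucc) (fun m => y m.castSucc))
    ((HuckelTrap R k (n+1) x y).submatrix e e)
    ?_ ?_ ?_ ?_ ?_ ?_ ?_
  · rw [Matrix.det_submatrix_equiv_self] at g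
    have hP : ∀ P, (P ≠ .inl 0 ∧ P ≠ .inl (Fin.last (n + 1))) ↔
        ¬ ((e P).1.1.val = n+1 ∧ ((e P).1.2.val = 0 ∨ (e P).1.2.val = 2*(n+1))) := by
      rintro (i | i | p)
      · simp [e, f, Fin.ext_iff, -Fin.val_eq_zero_iff]
      · simp [e, f]; omega
      · simp [e, f]; intro h; have := p.1.1.2; omega
    have h := Matrix.det_submatrix_equiv_self (e.subtypeEquiv hP)
      ((HuckelTrap R k (n+1) x y).submatrix
            (fun P : {P : TrapIdx k (n+1) //
                ¬ (P.1.1.val = n+1 ∧ (P.1.2.val = 0 ∨ P.1.2.val = 2*(n+1)))} => P.1)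
            (fun Q : {P : TrapIdx k (n+1) //
                ¬ (P.1.1.val = n+1 ∧ (P.1.2.val = 0 ∨ P.1.2.val = 2*(n+1)))} => Q.1))
    rw [Matrix.submatrix_submatrix] at h g
    rw [g, ← h]
    rfl
  · intro i j
    simp [e, f, HuckelTrap, Fin.ext_iff, -Fin.val_eq_zero_iff]
    grind
  · intro i j
    simp [e, f, HuckelTrap]
    grind
  · intro i j
    simp [e, f, HuckelTrap]
    grind
  · intro i p
    have := p.1.1.2
    have := p.1.2.2
    simp [e, f, HuckelTrap, Fin.ext_iff, -Fin.val_eq_zero_iff]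
    grind
  · intro i p
    have := p.1.1.2
    have := p.1.2.2
    simp [e, f, HuckelTrap, Fin.ext_iff, -Fin.val_eq_zero_iff]
    grind
  · intro i j
    simp [e, f, HuckelTrap]
    grind
  · intro i j
    simp [e, f, HuckelTrap]
end
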